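/- arXiv:2511.13499 — 2 statements merged into one kernel-verified Lean document; each statement's English description precedes it below -/
import Mathlib

section
/- (Pointwise lower bound on the soft-min Lie derivative.) Let N ≥ 1, let h_1, …, h_N : ℝⁿ → ℝ be differentiable, let F : ℝⁿ → ℝⁿ, and fix x ∈ ℝⁿ, θ > 0, and constants M, r, d > 0 with r ≤ M. Suppose that for every index i ∈ {1,…,N}: |L_F h_i(x)| ≤ M, and either L_F h_i(x) ≥ r or δ_i(x) := h_i(x) − ĥ(x) ≥ d. Then the Lie derivative of the soft-min satisfies L_F h̃_θ(x) ≥ r − (r + M) · N · e^{−θ d}. -/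
/-- The pointwise minimum `ĥ(x) = min_{1 ≤ i ≤ N} h_i(x)`. -/
noncomputable def hmin {n N : ℕ} (hN : 0 < N) (h : Fin N → (Fin n → ℝ) → ℝ)
    (x : Fin n → ℝ) : ℝ :=
  Finset.univ.inf' (Finset.univ_nonempty_iff.mpr ⟨⟨0, hN⟩⟩) fun i => h i x

/-- The soft-min (log-sum-exp) `h̃_θ(x) = -(1/θ) log (∑ i, exp (-θ h_i x))`. -/
noncomputable def softmin {n N : ℕ} (θ : ℝ) (h : Fin N → (Fin n → ℝ) → ℝ)
    (x : Fin n → ℝ) : ℝ :=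
  -(1 / θ) * Real.log (∑ i, Real.exp (-θ * h i x))

/-- The Lie derivative `L_F g(x) = D g(x)(F(x))` of `g` along the vector field `F`. -/
noncomputable def lieD {n : ℕ} (F : (Fin n → ℝ) → (Fin n → ℝ)) (g : (Fin n → ℝ) → ℝ)
    (x : Fin n → ℝ) : ℝ :=
  fderiv ℝ g x (F x)

/-- The Lie derivative of the soft-min is the soft-min weighted average of the Lie derivatives. -/
theorem lieD_softmin {n N : ℕ} (hN : 0 < N) (h : Fin N → (Fin n → ℝ) → ℝ)
    (F : (Fin n → ℝ) → (Fin n → ℝ)) (x : Fin n → ℝ) (hdiff : ∀ i, DifferentiableAt ℝ (h i) x)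
    {θ : ℝ} (hθ : θ ≠ 0) :
    lieD F (softmin θ h) x =
      (∑ i, Real.exp (-θ * h i x) * lieD F (h i) x) / ∑ i, Real.exp (-θ * h i x) := by
  have hS : 0 < ∑ i, Real.exp (-θ * h i x) :=
    Finset.sum_pos (fun i _ => Real.exp_pos _) (Finset.univ_nonempty_iff.mpr ⟨⟨0, hN⟩⟩)
  have hderiv := ((HasFDerivAt.fun_sum (u := Finset.univ) fun i _ =>
    ((hdiff i).hasFDerivAt.const_mul (-θ)).exp).log hS.ne').const_mul (-(1 / θ))
  have heq := congrArg (fun L : (Fin n → ℝ) →L[ℝ] ℝ => L (F x)) hderiv.fderiv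
  change lieD F (softmin θ h) x = _ at heq
  rw [heq]
  simp only [smul_apply, sum_apply, smul_eq_mul, lieD]
  have hsum : ∑ i, Real.exp (-θ * h i x) * (-θ * fderiv ℝ (h i) x (F x)) =
      -θ * ∑ i, Real.exp (-θ * h i x) * fderiv ℝ (h i) x (F x) := by
    rw [Finset.mul_sum]
    exact Finset.sum_congr rfl fun i _ => by ring
  rw [hsum]
  field_simp

/-- If `h i` exceeds the pointwise minimum by at least `d`, its soft-min weight is at most
`exp (-θ d)`. -/
theorem exp_le_exp_mul_sum_of_le_sub_hmin {n N : ℕ} (hN : 0 < N)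
    (h : Fin N → (Fin n → ℝ) → ℝ) (x : Fin n → ℝ) {θ d : ℝ} (hθ : 0 ≤ θ) {i : Fin N}
    (hi : d ≤ h i x - hmin hN h x) :
    Real.exp (-θ * h i x) ≤ Real.exp (-θ * d) * ∑ j, Real.exp (-θ * h j x) := by
  obtain ⟨k, -, hk⟩ := Finset.exists_mem_eq_inf'
    (Finset.univ_nonempty_iff.mpr ⟨⟨0, hN⟩⟩) fun j => h j x
  change hmin hN h x = h k x at hk
  rw [hk] at hi
  calc Real.exp (-θ * h i x) ≤ Real.exp (-θ * d + -θ * h k x) :=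
        Real.exp_le_exp.mpr (by nlinarith)
    _ = Real.exp (-θ * d) * Real.exp (-θ * h k x) := Real.exp_add _ _
    _ ≤ Real.exp (-θ * d) * ∑ j, Real.exp (-θ * h j x) := by
        gcongr
        exact Finset.single_le_sum (f := fun j => Real.exp (-θ * h j x))
          (fun j _ => (Real.exp_pos _).le) (Finset.mem_univ k)

/-- pointwise lower bound on the soft-min Lie derivative: if
`|L_F h_i(x)| ≤ M` for all `i`, and every `i` has either `L_F h_i(x) ≥ r` or
`δ_i(x) = h_i(x) - ĥ(x) ≥ d`, then
`L_F h̃_θ(x) ≥ r - (r + M) N e^{-θd}`. -/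
theorem softmin_lie_derivative_lower_bound {n N : ℕ} (hN : 0 < N)
    (h : Fin N → (Fin n → ℝ) → ℝ) (hdiff : ∀ i, Differentiable ℝ (h i))
    (F : (Fin n → ℝ) → (Fin n → ℝ)) (x : Fin n → ℝ)
    (θ M r d : ℝ) (hθ : 0 < θ) (hM : 0 < M) (hr : 0 < r) (hd : 0 < d) (hrM : r ≤ M)
    (hbound : ∀ i, |lieD F (h i) x| ≤ M)
    (halt : ∀ i, r ≤ lieD F (h i) x ∨ d ≤ h i x - hmin hN h x) :
    r - (r + M) * (N : ℝ) * Real.exp (-θ * d) ≤ lieD F (softmin θ h) x := by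
  have hS : 0 < ∑ i, Real.exp (-θ * h i x) :=
    Finset.sum_pos (fun i _ => Real.exp_pos _) (Finset.univ_nonempty_iff.mpr ⟨⟨0, hN⟩⟩)
  rw [lieD_softmin hN h F x (fun i => hdiff i x) hθ.ne', le_div_iff₀ hS]
  have key : ∀ i, r * Real.exp (-θ * h i x) -
      (r + M) * (Real.exp (-θ * d) * ∑ j, Real.exp (-θ * h j x)) ≤
      Real.exp (-θ * h i x) * lieD F (h i) x := by
    intro i
    have he := Real.exp_pos (-θ * h i x)
    rcases halt i with hi | hi
    · have hnonneg : 0 ≤ (r + M) * (Real.exp (-θ * d) * ∑ j, Real.exp (-θ * h j x)) := by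
        positivity
      linarith [mul_le_mul_of_nonneg_left hi he.le]
    · have hweight := mul_le_mul_of_nonneg_left
        (exp_le_exp_mul_sum_of_le_sub_hmin hN h x hθ.le hi) (add_pos hr hM).le
      linarith [mul_le_mul_of_nonneg_left (abs_le.mp (hbound i)).1 he.le]
  have hsum := Finset.sum_le_sum fun i (_ : i ∈ Finset.univ) => key i
  rw [Finset.sum_sub_distrib, ← Finset.mul_sum, Finset.sum_const, Finset.card_univ,
    Fintype.card_fin, nsmul_eq_mul] at hsum
  linarith
end

section
/- (Corollary 1, boundary positivity: all active backup constraints have strictly positive Lie derivative on the boundary of the backup safe set.) Let F_b : ℝⁿ → ℝⁿ and let φ : ℝ × ℝⁿ → ℝⁿ be a continuous map satisfying the flow laws φ(0,x) = x, φ(s, φ(t,x)) = φ(s+t,x), such that s ↦ φ(s,x) is differentiable at 0 with derivative F_b(x) for every x, and x ↦ φ(t,x) is differentiable for every t. Let h, h_b : ℝⁿ → ℝ be continuously differentiable, S_b := {h_b ≥ 0}, T ≥ 0, τ_1,…,τ_{N−1} ∈ [0,T], b_i(x) := h(φ(τ_i,x)) for i < N and b_N(x) := h_b(φ(T,x)),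 and B̂ := {x : b_i(x) ≥ 0, ∀i}. Assume: (i) strict safety of S_b: for every y ∈ S_b and s > 0, φ(s,y) ∈ interior(S_b); (ii) for every y with h_b(y) = 0, L_{F_b} h_b(y) > 0; (iii) for every y with h(y) = 0 and φ(T, y) ∈ S_b, L_{F_b} h(y) > 0. Then for every x ∈ B̂ with min_i b_i(x) = 0 and every index i with b_i(x) = 0, one has L_{F_b} b_i(x) > 0. -/
/-- The flow pushes its generator forward to itself: `D(φ t)(x)(F x) = F (φ t x)`. -/
theorem fderiv_flow_apply_generator {n : ℕ}
    {F : (Fin n → ℝ) → (Fin n → ℝ)} {φ : ℝ → (Fin n → ℝ) → (Fin n → ℝ)}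
    (hφ0 : ∀ x, φ 0 x = x) (hφadd : ∀ s t : ℝ, ∀ x, φ s (φ t x) = φ (s + t) x)
    (hderiv0 : ∀ x, HasDerivAt (fun s : ℝ => φ s x) (F x) 0)
    {t : ℝ} {x : Fin n → ℝ} (hφdiff : DifferentiableAt ℝ (φ t) x) :
    fderiv ℝ (φ t) x (F x) = F (φ t x) := by
  have hcomp : HasDerivAt (fun s : ℝ => φ t (φ s x)) (fderiv ℝ (φ t) x (F x)) 0 :=
    hφdiff.hasFDerivAt.comp_hasDerivAt_of_eq 0 (hderiv0 x) (hφ0 x).symm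
  have hcomm : (fun s : ℝ => φ t (φ s x)) = fun s => φ s (φ t x) := by
    funext s
    rw [hφadd, hφadd, add_comm]
  rw [hcomm] at hcomp
  exact hcomp.unique (hderiv0 _)

/-- Lie derivatives along the generator of a flow commute with composition with the flow. -/
theorem lieD_comp_flow {n : ℕ}
    {F : (Fin n → ℝ) → (Fin n → ℝ)} {φ : ℝ → (Fin n → ℝ) → (Fin n → ℝ)}
    (hφ0 : ∀ x, φ 0 x = x) (hφadd : ∀ s t : ℝ, ∀ x, φ s (φ t x) = φ (s + t) x)
    (hderiv0 : ∀ x, HasDerivAt (fun s : ℝ => φ s x) (F x) 0)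
    {t : ℝ} {x : Fin n → ℝ} (hφdiff : DifferentiableAt ℝ (φ t) x)
    {g : (Fin n → ℝ) → ℝ} (hg : DifferentiableAt ℝ g (φ t x)) :
    lieD F (fun y => g (φ t y)) x = lieD F g (φ t x) := by
  have hchain : fderiv ℝ (fun y => g (φ t y)) x = (fderiv ℝ g (φ t x)).comp (fderiv ℝ (φ t) x) :=
    fderiv_comp x hg hφdiff
  rw [lieD, lieD, hchain, ContinuousLinearMap.comp_apply,
    fderiv_flow_apply_generator hφ0 hφadd hderiv0 hφdiff]

/-- Corollary 1, boundary positivity: under strict safety of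
`S_b = {h_b ≥ 0}` under the backup flow `φ` of `F_b` (i), regularity `L_{F_b} h_b > 0`
on `{h_b = 0}` (ii), and Assumption 2, `L_{F_b} h > 0` on the backup-reachable
boundary `{h = 0} ∩ {y : φ(T,y) ∈ S_b}` (iii), every constraint
`b_i(x) = h(φ(τ_i,x))` (for `i < N`) or `b_N(x) = h_b(φ(T,x))` that is active at a
boundary point `x` of `B̂` has strictly positive Lie derivative along `F_b`. -/
theorem backup_boundary_positivity {n m : ℕ}
    (Fb : (Fin n → ℝ) → (Fin n → ℝ))
    (φ : ℝ → (Fin n → ℝ) → (Fin n → ℝ))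
    (hcont : Continuous fun p : ℝ × (Fin n → ℝ) => φ p.1 p.2)
    (hφ0 : ∀ x, φ 0 x = x)
    (hφadd : ∀ s t : ℝ, ∀ x, φ s (φ t x) = φ (s + t) x)
    (hderiv0 : ∀ x, HasDerivAt (fun s : ℝ => φ s x) (Fb x) 0)
    (hφdiff : ∀ t : ℝ, Differentiable ℝ (φ t))
    (h hb : (Fin n → ℝ) → ℝ) (hhC1 : ContDiff ℝ 1 h) (hhbC1 : ContDiff ℝ 1 hb)
    (T : ℝ) (hT : 0 ≤ T) (τ : Fin m → ℝ) (hτ : ∀ i, τ i ∈ Set.Icc (0:ℝ) T)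
    (hsafe : ∀ y : Fin n → ℝ, 0 ≤ hb y → ∀ s : ℝ, 0 < s →
      φ s y ∈ interior {z : Fin n → ℝ | 0 ≤ hb z})
    (hreg : ∀ y : Fin n → ℝ, hb y = 0 → 0 < lieD Fb hb y)
    (hassump : ∀ y : Fin n → ℝ, h y = 0 → 0 ≤ hb (φ T y) → 0 < lieD Fb h y) :
    ∀ x : Fin n → ℝ, (∀ i, 0 ≤ h (φ (τ i) x)) → 0 ≤ hb (φ T x) →
      (∀ i, h (φ (τ i) x) = 0 →
        0 < lieD Fb (fun y => h (φ (τ i) y)) x) ∧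
      (hb (φ T x) = 0 →
        0 < lieD Fb (fun y => hb (φ T y)) x) := by
  intro x _ hTx
  refine ⟨fun i hi => ?_, fun hxT => ?_⟩
  · rw [lieD_comp_flow hφ0 hφadd hderiv0 (hφdiff _ x) (hhC1.differentiable one_ne_zero _)]
    refine hassump _ hi ?_
    have hswap : φ T (φ (τ i) x) = φ (τ i) (φ T x) := by
      rw [hφadd, hφadd, add_comm]
    rw [hswap]
    rcases (hτ i).1.eq_or_lt with hzero | hpos
    · rwa [← hzero, hφ0]
    · have hmem := interior_subset (hsafe _ hTx _ hpos)
      exact hmem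
  · rw [lieD_comp_flow hφ0 hφadd hderiv0 (hφdiff _ x) (hhbC1.differentiable one_ne_zero _)]
    exact hreg _ hxT
end
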